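/- arXiv:2510.00870 — 2 statements merged into one kernel-verified Lean document; each statement's English description precedes it below -/
import Mathlib

section
/- Let m be a positive odd integer. Then J(m) := ∫₀¹ log(x^m + 1)/(x + 1) dx = (m/2)·log²2 − (m² − 1)π²/(24m) + (1/2)·Σ_{k=0}^{(m-3)/2} Li₂( cos²((2k+1)π/(2m)) ), where the sum is empty (equal to 0) when m = 1. -/
open Real MeasureTheory intervalIntegral Finset

/-- Dilogarithm Li₂(z) = Σ_{k≥1} z^k/k². -/
noncomputable def Li2 (x : ℝ) : ℝ := ∑' k : ℕ, x ^ (k + 1) / ((k : ℝ) + 1) ^ 2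

lemma Li2_cont : ContinuousOn Li2 (Set.Icc 0 1) := by
  unfold Li2
  have hs : Summable (fun k : ℕ => 1 / ((k : ℝ) + 1) ^ 2) := by
    have := (summable_nat_add_iff 1).2 (Real.summable_one_div_nat_pow (p := 2) |>.2 (by norm_num))
    simpa using this
  refine continuousOn_tsum (fun i => by fun_prop) hs ?_
  intro n x hx
  rw [Real.norm_eq_abs, abs_of_nonneg (by have := hx.1; positivity)]
  gcongr
  exact pow_le_one₀ hx.1 hx.2

lemma Li2_deriv {x : ℝ} (h0 : 0 < x) (h1 : x < 1) :
    HasDerivAt Li2 (-log (1 - x) / x) x := by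
  obtain ⟨r, hxr, hr1⟩ := exists_between h1
  have hr0 : 0 < r := h0.trans hxr
  have key : HasDerivAt (fun z : ℝ => ∑' k : ℕ, z ^ (k + 1) / ((k : ℝ) + 1) ^ 2)
      (∑' k : ℕ, x ^ k / ((k : ℝ) + 1)) x := by
    refine hasDerivAt_tsum_of_isPreconnected (𝕜 := ℝ) (F := ℝ) (g := fun (k : ℕ) (z : ℝ) => z ^ (k + 1) / ((k : ℝ) + 1) ^ 2)
      (g' := fun (k : ℕ) (z : ℝ) => z ^ k / ((k : ℝ) + 1)) (u := fun k : ℕ => r ^ k)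
      (t := Set.Ioo (-r) r) (y₀ := 0)
      (summable_geometric_of_lt_one hr0.le hr1) isOpen_Ioo isPreconnected_Ioo ?_ ?_ ?_ ?_ ?_
    · intro n y hy
      have := (hasDerivAt_pow (n + 1) y).div_const (((n : ℝ) + 1) ^ 2)
      refine HasDerivAt.congr_deriv this ?_
      push_cast
      have : (n : ℝ) + 1 ≠ 0 := by positivity
      field_simp
    · intro n y hy
      rw [norm_div, norm_pow, Real.norm_eq_abs, Real.norm_eq_abs, abs_of_pos (by positivity : (0:ℝ) < n + 1)]
      have h2 : |y| ^ n ≤ r ^ n := by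
        gcongr
        exact (abs_lt.2 hy).le
      refine (div_le_self (by positivity) ?_).trans h2
      have : (0:ℝ) ≤ n := by positivity
      linarith
    · constructor <;> linarith
    · simp
    · constructor <;> linarith
  have hsum := (Real.hasSum_pow_div_log_of_abs_lt_one (x := x) (by rw [abs_of_pos h0]; exact h1)).div_const x
  have h2 : ∑' k : ℕ, x ^ k / ((k : ℝ) + 1) = -log (1 - x) / x := by
    rw [← hsum.tsum_eq]
    congr 1
    ext k
    field_simp
    ring
  rw [← h2]
  exact key

lemma q_lower {x φ : ℝ} (h0 : 0 ≤ x) : sin φ ^ 2 ≤ (1 - x) ^ 2 + 4 * x * sin φ ^ 2 := by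
  nlinarith [sin_sq_add_cos_sq φ, sq_nonneg (cos φ), mul_nonneg (sq_nonneg (1 - x)) (sq_nonneg (cos φ)), mul_nonneg h0 (sq_nonneg (sin φ)), mul_nonneg (sq_nonneg x) (sq_nonneg (sin φ)), sq_nonneg (sin φ)]

lemma I_int {φ : ℝ} (h : sin φ ≠ 0) : 
    ContinuousOn (fun x => log ((1 - x) ^ 2 + 4 * x * sin φ ^ 2) / (x + 1)) (Set.uIcc 0 1) := by
  rw [Set.uIcc_of_le zero_le_one]
  have : 0 < sin φ ^ 2 := by positivity
  refine ContinuousOn.div (ContinuousOn.log (by fun_prop) ?_) (by fun_prop) ?_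
  · intro x hx
    have := q_lower (φ := φ) hx.1
    linarith
  · intro x hx
    have := hx.1
    positivity

lemma I_deriv0 {φ : ℝ} (h : sin φ ≠ 0) :
    HasDerivAt (fun φ => ∫ x in (0:ℝ)..1, log ((1 - x) ^ 2 + 4 * x * sin φ ^ 2) / (x + 1))
      (∫ x in (0:ℝ)..1, 8 * x * sin φ * cos φ / ((1 - x) ^ 2 + 4 * x * sin φ ^ 2) / (x + 1)) φ := by
  have hp : 0 < sin φ ^ 2 := by positivity
  have hs : {ψ : ℝ | sin φ ^ 2 / 2 < sin ψ ^ 2} ∈ nhds φ := by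
    refine (isOpen_lt (by fun_prop) (by fun_prop)).mem_nhds ?_
    simp only [Set.mem_ofPred_eq]
    linarith
  have hI : Set.uIoc (0:ℝ) 1 = Set.Ioc 0 1 := Set.uIoc_of_le zero_le_one
  refine (intervalIntegral.hasDerivAt_integral_of_dominated_loc_of_deriv_le hs
    (bound := fun _ => 8 / (sin φ ^ 2 / 2)) 
    (F' := fun φ x => 8 * x * sin φ * cos φ / ((1 - x) ^ 2 + 4 * x * sin φ ^ 2) / (x + 1))
    ?_ (I_int h).intervalIntegrable ?_ ?_ ?_ ?_).2
  · exact Filter.Eventually.of_forall fun ψ => 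
      (by fun_prop : Measurable fun x : ℝ => log ((1 - x) ^ 2 + 4 * x * sin ψ ^ 2) / (x + 1)).aestronglyMeasurable
  · exact (by fun_prop : Measurable fun x : ℝ => 8 * x * sin φ * cos φ / ((1 - x) ^ 2 + 4 * x * sin φ ^ 2) / (x + 1)).aestronglyMeasurable
  · refine Filter.Eventually.of_forall fun x hx ψ hψ => ?_
    rw [hI] at hx
    simp only [Set.mem_ofPred_eq] at hψ
    have hx0 := hx.1
    have hq := q_lower (φ := ψ) hx.1.le
    have hqp : 0 < (1 - x) ^ 2 + 4 * x * sin ψ ^ 2 := by linarith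
    rw [norm_div, norm_div, Real.norm_eq_abs, Real.norm_eq_abs, Real.norm_eq_abs, abs_of_pos hqp,
      abs_of_pos (by linarith : 0 < x + 1)]
    have hnum : |8 * x * sin ψ * cos ψ| ≤ 8 := by
      rw [abs_mul, abs_mul, abs_mul, abs_of_pos hx0, abs_of_pos (by norm_num : (0:ℝ) < 8)]
      have h1 := abs_sin_le_one ψ
      have h2 := abs_cos_le_one ψ
      have h3 : x * |sin ψ| ≤ 1 := mul_le_one₀ hx.2 (abs_nonneg _) h1
      have h4 : x * |sin ψ| * |cos ψ| ≤ 1 := mul_le_one₀ h3 (abs_nonneg _) h2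
      linarith
    refine (div_le_self (by positivity) (by linarith)).trans ?_
    gcongr
    linarith
  · exact intervalIntegrable_const
  · refine Filter.Eventually.of_forall fun x hx ψ hψ => ?_
    rw [hI] at hx
    simp only [Set.mem_ofPred_eq] at hψ
    have hq := q_lower (φ := ψ) hx.1.le
    have hqp : 0 < (1 - x) ^ 2 + 4 * x * sin ψ ^ 2 := by linarith
    have := ((((Real.hasDerivAt_sin ψ).pow 2).const_mul (4 * x)).const_add ((1 - x) ^ 2)).log hqp.ne'
    refine HasDerivAt.congr_deriv (this.div_const (x + 1)) ?_
    simp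
    ring

lemma I_val {φ : ℝ} (h0 : 0 < φ) (h1 : φ < π / 2) :
    ∫ x in (0:ℝ)..1, 8 * x * sin φ * cos φ / ((1 - x) ^ 2 + 4 * x * sin φ ^ 2) / (x + 1)
     = 2 * tan φ * log (sin φ) + (π - 2 * φ) := by
  have hS : 0 < sin φ := sin_pos_of_pos_of_lt_pi h0 (by linarith)
  have hC : 0 < cos φ := cos_pos_of_mem_Ioo ⟨by linarith, h1⟩
  have hsc := sin_sq_add_cos_sq φ
  have hI : Set.uIcc (0:ℝ) 1 = Set.Icc 0 1 := Set.uIcc_of_le zero_le_one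
  rw [intervalIntegral.integral_eq_sub_of_hasDerivAt (f := fun x => 
    2 * (sin φ / cos φ) * (-log (x + 1) + 1/2 * log ((1 - x) ^ 2 + 4 * x * sin φ ^ 2))
      + 2 * arctan ((x - (1 - 2 * sin φ ^ 2)) / (2 * sin φ * cos φ)))]
  · have e1 : (1 - (1 - 2 * sin φ ^ 2)) / (2 * sin φ * cos φ) = tan φ := by
      rw [tan_eq_sin_div_cos]; field_simp; ring
    have e2 : (0 - (1 - 2 * sin φ ^ 2)) / (2 * sin φ * cos φ) = tan (2 * φ - π / 2) := by
      rw [tan_eq_sin_div_cos, sin_sub_pi_div_two, cos_sub_pi_div_two, sin_two_mul, cos_two_mul,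
        cos_sq']
      ring
    rw [e1, e2, arctan_tan (by linarith) h1, arctan_tan (by linarith) (by linarith)]
    have e3 : ((1:ℝ) - 1) ^ 2 + 4 * 1 * sin φ ^ 2 = (2 * sin φ) ^ 2 := by ring
    rw [e3, log_pow, log_mul (by norm_num) hS.ne', tan_eq_sin_div_cos]
    norm_num
    ring
  · intro x hx
    rw [hI] at hx
    have hx0 := hx.1
    have hq := q_lower (φ := φ) hx.1
    have hqp : 0 < (1 - x) ^ 2 + 4 * x * sin φ ^ 2 := by nlinarith
    have d1 := ((hasDerivAt_id x).add_const 1).log (by simp; linarith)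
    have d2 : HasDerivAt (fun x => (1 - x) ^ 2 + 4 * x * sin φ ^ 2) (-2 * (1 - x) + 4 * sin φ ^ 2) x := by
      have := (((hasDerivAt_id x).const_sub 1).pow 2).add (((hasDerivAt_id x).const_mul 4).mul_const (sin φ ^ 2))
      refine HasDerivAt.congr_deriv this ?_
      simp
    have d3 := d2.log hqp.ne'
    have d4 := (((hasDerivAt_id x).sub_const (1 - 2 * sin φ ^ 2)).div_const (2 * sin φ * cos φ)).arctan
    have := ((d1.neg.add (d3.const_mul (1/2))).const_mul (2 * (sin φ / cos φ))).add (d4.const_mul 2)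
    refine HasDerivAt.congr_deriv this ?_
    simp only [id]
    have hA : 1 + ((x - (1 - 2 * sin φ ^ 2)) / (2 * sin φ * cos φ)) ^ 2 = 
       ((1 - x) ^ 2 + 4 * x * sin φ ^ 2) / (2 * sin φ * cos φ) ^ 2 := by
      field_simp
      rw [show cos φ ^ 2 = 1 - sin φ ^ 2 by linarith]
      ring
    rw [hA]
    generalize hQ : (1 - x) ^ 2 + 4 * x * sin φ ^ 2 = Q at *
    have : x + 1 ≠ 0 := by positivity
    field_simp
    rw [← hQ, show cos φ ^ 2 = 1 - sin φ ^ 2 by linarith]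
    ring
  · apply ContinuousOn.intervalIntegrable
    rw [hI]
    have : 0 < sin φ ^ 2 := by positivity
    refine ContinuousOn.div (ContinuousOn.div (by fun_prop) (by fun_prop) ?_) (by fun_prop) ?_
    · intro x hx
      have := q_lower (φ := φ) hx.1
      linarith
    · intro x hx
      have := hx.1
      positivity

lemma int_log : ∫ x in (0:ℝ)..1, log (x + 1) / (x + 1) = log 2 ^ 2 / 2 := by
  rw [intervalIntegral.integral_eq_sub_of_hasDerivAt (f := fun x => log (x + 1) ^ 2 / 2)]
  · norm_num
  · intro x hx
    rw [Set.uIcc_of_le zero_le_one] at hx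
    have hx0 := hx.1
    have d1 := ((hasDerivAt_id x).add_const 1).log (by simp; linarith)
    refine HasDerivAt.congr_deriv ((d1.pow 2).div_const 2) ?_
    simp
    ring
  · apply ContinuousOn.intervalIntegrable
    rw [Set.uIcc_of_le zero_le_one]
    have : ∀ x ∈ Set.Icc (0:ℝ) 1, x + 1 ≠ 0 := fun x hx => by have := hx.1; positivity
    exact ContinuousOn.div (ContinuousOn.log (by fun_prop) this) (by fun_prop) this

lemma I_closed {φ : ℝ} (h0 : 0 < φ) (h1 : φ < π / 2) :
    ∫ x in (0:ℝ)..1, log ((1 - x) ^ 2 + 4 * x * sin φ ^ 2) / (x + 1)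
     = log 2 ^ 2 + 1 / 2 * Li2 (cos φ ^ 2) - (π / 2 - φ) ^ 2 := by
  set F : ℝ → ℝ := fun φ => (∫ x in (0:ℝ)..1, log ((1 - x) ^ 2 + 4 * x * sin φ ^ 2) / (x + 1))
    - 1 / 2 * Li2 (cos φ ^ 2) + (π / 2 - φ) ^ 2 with hF
  have hpos : ∀ y ∈ Set.Icc φ (π / 2), 0 < sin y := fun y hy =>
    sin_pos_of_pos_of_lt_pi (by linarith [hy.1]) (by linarith [hy.2, pi_pos])
  have hc : ContinuousOn F (Set.Icc φ (π / 2)) := by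
    refine ContinuousOn.add (ContinuousOn.sub ?_ (ContinuousOn.mul continuousOn_const ?_)) (by fun_prop)
    · intro y hy
      exact (I_deriv0 (hpos y hy).ne').continuousAt.continuousWithinAt
    · refine Li2_cont.comp (t := Set.Icc 0 1) (f := fun φ : ℝ => cos φ ^ 2) (by fun_prop) ?_
      intro y _
      exact ⟨sq_nonneg _, cos_sq_le_one y⟩
  have hd : ∀ x ∈ Set.Ico φ (π / 2), HasDerivWithinAt F 0 (Set.Ici x) x := by
    intro y hy
    have hS := hpos y ⟨hy.1, hy.2.le⟩
    have hC : 0 < cos y := cos_pos_of_mem_Ioo ⟨by linarith [hy.1], hy.2⟩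
    have hsc := sin_sq_add_cos_sq y
    have a1 := I_deriv0 hS.ne'
    rw [I_val (by linarith [hy.1]) hy.2] at a1
    have a2 := (Li2_deriv (x := cos y ^ 2) (by positivity) (by nlinarith)).comp y
      ((Real.hasDerivAt_cos y).pow 2)
    have a3 := ((hasDerivAt_id y).const_sub (π / 2)).pow 2
    have := (a1.sub (a2.const_mul (1/2))).add a3
    refine (HasDerivAt.congr_deriv this ?_).hasDerivWithinAt
    rw [show 1 - cos y ^ 2 = sin y ^ 2 by linarith, log_pow, tan_eq_sin_div_cos]
    simp
    field_simp
    ring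
  have := constant_of_has_deriv_right_zero hc hd (π / 2) ⟨h1.le, le_rfl⟩
  have hend : F (π / 2) = log 2 ^ 2 := by
    have e : ∀ x : ℝ, log ((1 - x) ^ 2 + 4 * x * sin (π / 2) ^ 2) / (x + 1) = 2 * (log (x + 1) / (x + 1)) := by
      intro x
      rw [sin_pi_div_two, show (1 - x) ^ 2 + 4 * x * 1 ^ 2 = (x + 1) ^ 2 by ring, log_pow]
      push_cast
      ring
    simp only [hF, e, intervalIntegral.integral_const_mul, int_log]
    simp [Li2]
    ring
  rw [hend] at this
  simp only [hF] at this
  linarith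

lemma factor (n : ℕ) (x : ℝ) : x ^ (2 * n + 1) + 1 = (x + 1) * ∏ k ∈ Finset.range n,
    ((1 - x) ^ 2 + 4 * x * sin ((2 * (k : ℝ) + 1) * π / (2 * (2 * n + 1 : ℕ))) ^ 2) := by
  have hm : (2 * n + 1 : ℕ) ≠ 0 := by omega
  have hζ := Complex.isPrimitiveRoot_exp (2 * n + 1) hm
  set ζ := Complex.exp (2 * π * Complex.I / (2 * n + 1 : ℕ)) with hz
  have h := X_pow_sub_C_eq_prod (R := ℂ) hζ (by omega) (α := -1) (a := -1) (by
    rw [Odd.neg_one_pow ⟨n, rfl⟩])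
  have h2 := congrArg (Polynomial.eval (x : ℂ)) h
  simp only [Polynomial.eval_sub, Polynomial.eval_pow, Polynomial.eval_X, Polynomial.eval_C,
    Polynomial.eval_prod] at h2
  apply Complex.ofReal_injective
  push_cast
  rw [show (x:ℂ) ^ (2 * n + 1) + 1 = x ^ (2 * n + 1) - (-1) by ring, h2, Finset.prod_range_succ',
    two_mul, Finset.prod_range_add, ← Finset.prod_range_reflect _ n, ← Finset.prod_mul_distrib, mul_comm]
  congr 1
  · simp
  refine Finset.prod_congr rfl fun k hk => ?_
  rw [Finset.mem_range] at hk
  set A := ζ ^ (n - 1 - k + 1) with hA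
  set B := ζ ^ (n + k + 1) with hB
  have hAB : A * B = 1 := by
    rw [hA, hB, ← pow_add, ← hζ.pow_eq_one]
    congr 1
    omega
  have hS : A + B = 2 * (2 * (Complex.sin ((2 * (k : ℂ) + 1) * π / (2 * (2 * n + 1)))) ^ 2 - 1) := by
    have hB2 : B = - Complex.exp (((2 * (k : ℂ) + 1) * π / (2 * n + 1)) * Complex.I) := by
      rw [hB, hz, ← Complex.exp_nat_mul, ← neg_one_mul, ← Complex.exp_pi_mul_I, ← Complex.exp_add]
      congr 1
      have : (2 * (n:ℂ) + 1) ≠ 0 := by exact_mod_cast hm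
      push_cast
      rw [← mul_div_assoc, div_eq_iff this]
      have hd := div_mul_cancel₀ ((2 * (k : ℂ) + 1) * π) this
      linear_combination -Complex.I * hd
    have hA2 : A = - Complex.exp (-((2 * (k : ℂ) + 1) * π / (2 * n + 1)) * Complex.I) := by
      have : A = B⁻¹ := eq_inv_of_mul_eq_one_left hAB
      rw [this, hB2, inv_neg, ← Complex.exp_neg, neg_mul]
    have hcos := Complex.two_cos ((2 * (k : ℂ) + 1) * π / (2 * n + 1))
    have h3 : (2 * (k : ℂ) + 1) * π / (2 * n + 1) = 2 * ((2 * (k : ℂ) + 1) * π / (2 * (2 * n + 1))) := by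
      field_simp
    rw [hA2, hB2]
    have h4 := Complex.cos_two_mul ((2 * (k : ℂ) + 1) * π / (2 * (2 * n + 1)))
    rw [← h3, Complex.cos_sq'] at h4
    rw [h4] at hcos
    linear_combination hcos
  linear_combination hAB + x * hS

theorem stmt_3 (m : ℕ) (hm : Odd m) (hm0 : 0 < m) :
    ∫ x in (0:ℝ)..1, Real.log (x ^ m + 1) / (x + 1) =
      (m : ℝ) / 2 * Real.log 2 ^ 2 - ((m : ℝ) ^ 2 - 1) * π ^ 2 / (24 * m)
        + (1 / 2) * ∑ k ∈ Finset.range ((m - 1) / 2),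
            Li2 (Real.cos ((2 * (k : ℝ) + 1) * π / (2 * m)) ^ 2) := by
  obtain ⟨n, rfl⟩ := hm
  have hn : (2 * n + 1 - 1) / 2 = n := by omega
  rw [hn]
  set φ : ℕ → ℝ := fun k => (2 * (k : ℝ) + 1) * π / (2 * (2 * n + 1 : ℕ)) with hφ
  have hφ0 : ∀ k ∈ Finset.range n, 0 < φ k ∧ φ k < π / 2 := by
    intro k hk
    have hk' : (k : ℝ) < n := by exact_mod_cast Finset.mem_range.1 hk
    have := pi_pos
    refine ⟨by simp only [hφ]; positivity, ?_⟩
    simp only [hφ]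
    push_cast
    rw [div_lt_div_iff₀ (by positivity) (by positivity)]
    nlinarith
  have hS : ∀ k ∈ Finset.range n, 0 < sin (φ k) := fun k hk =>
    sin_pos_of_pos_of_lt_pi (hφ0 k hk).1 (by linarith [(hφ0 k hk).2, pi_pos])
  have e : ∫ x in (0:ℝ)..1, Real.log (x ^ (2 * n + 1) + 1) / (x + 1) = 
    ∫ x in (0:ℝ)..1, (log (x + 1) / (x + 1) + ∑ k ∈ Finset.range n,
      log ((1 - x) ^ 2 + 4 * x * sin (φ k) ^ 2) / (x + 1)) := by
    refine intervalIntegral.integral_congr fun x hx => ?_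
    rw [Set.uIcc_of_le zero_le_one] at hx
    have hx0 := hx.1
    have hq : ∀ k ∈ Finset.range n, (1 - x) ^ 2 + 4 * x * sin (φ k) ^ 2 ≠ 0 := by
      intro k hk
      have := q_lower (φ := φ k) hx0
      have h2 := pow_pos (hS k hk) 2
      linarith
    rw [factor, log_mul (by positivity) (Finset.prod_ne_zero_iff.2 hq), log_prod hq, add_div,
      Finset.sum_div]
  have hi : ∀ k ∈ Finset.range n, IntervalIntegrable 
      (fun x => log ((1 - x) ^ 2 + 4 * x * sin (φ k) ^ 2) / (x + 1)) volume 0 1 := fun k hk =>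
    (I_int (hS k hk).ne').intervalIntegrable
  have hi0 : IntervalIntegrable (fun x : ℝ => log (x + 1) / (x + 1)) volume 0 1 := by
    apply ContinuousOn.intervalIntegrable
    rw [Set.uIcc_of_le zero_le_one]
    have : ∀ x ∈ Set.Icc (0:ℝ) 1, x + 1 ≠ 0 := fun x hx => by have := hx.1; positivity
    exact ContinuousOn.div (ContinuousOn.log (by fun_prop) this) (by fun_prop) this
  rw [e, intervalIntegral.integral_add hi0 (by
      have := IntervalIntegrable.sum (Finset.range n) hi
      refine this.congr ?_
      exact fun x _ => by simp [Finset.sum_apply]), intervalIntegral.integral_finsetSum hi, int_log,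
    Finset.sum_congr rfl fun k hk => I_closed (hφ0 k hk).1 (hφ0 k hk).2,
    Finset.sum_sub_distrib, Finset.sum_add_distrib, ← Finset.mul_sum]
  have hsq : ∑ k ∈ Finset.range n, (π / 2 - φ k) ^ 2 = 
      (((2 * n + 1 : ℕ) : ℝ) ^ 2 - 1) * π ^ 2 / (24 * (2 * n + 1 : ℕ)) := by
    rw [← Finset.sum_range_reflect]
    have h1 : ∀ k ∈ Finset.range n, (π / 2 - φ (n - 1 - k)) ^ 2 = 
       ((k : ℝ) + 1) ^ 2 * (π / (2 * n + 1)) ^ 2 := by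
      intro k hk
      have hk' := Finset.mem_range.1 hk
      have : ((n - 1 - k : ℕ) : ℝ) = n - 1 - k := by
        rw [Nat.cast_sub (by omega), Nat.cast_sub (by omega)]; simp
      simp only [hφ, this]
      push_cast
      field_simp
      ring
    rw [Finset.sum_congr rfl h1, ← Finset.sum_mul]
    have h2 : ∀ n : ℕ, ∑ k ∈ Finset.range n, ((k : ℝ) + 1) ^ 2 = (n : ℝ) * (n + 1) * (2 * n + 1) / 6 := by
      intro n
      induction n with
      | zero => simp
      | succ n ih => rw [Finset.sum_range_succ, ih]; push_cast; ring
    rw [h2]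
    push_cast
    field_simp
    ring
  rw [hsq]
  change _ = _ + 1 / 2 * ∑ k ∈ Finset.range n, Li2 (cos (φ k) ^ 2)
  simp only [Finset.sum_const, Finset.card_range, nsmul_eq_mul]
  push_cast
  ring
end

section
/- ∫₀¹ log(x³ + 1)/(x² + 1) dx = −(π/8)·log 2 − G + (π/2)·log(1 + √3) − Ti₂(2 − √3). -/
open Real MeasureTheory intervalIntegral Finset

/-- Inverse tangent integral Ti₂(x) = ∫₀ˣ arctan u / u du. -/
noncomputable def Ti2 (x : ℝ) : ℝ := ∫ u in (0:ℝ)..x, Real.arctan u / u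

/-- Catalan's constant G = Σ_{k≥0} (-1)^k/(2k+1)². -/
noncomputable def catalanG : ℝ := ∑' k : ℕ, (-1 : ℝ) ^ k / (2 * (k : ℝ) + 1) ^ 2

lemma aux_arctan_le {u : ℝ} (hu : 0 ≤ u) : Real.arctan u ≤ u := by
  have h1 : 0 ≤ Real.arctan u := Real.arctan_nonneg.2 hu
  have h2 := Real.le_tan h1 (Real.arctan_lt_pi_div_two u)
  rwa [Real.tan_arctan] at h2

lemma aux_bound (u : ℝ) : ‖Real.arctan u / u‖ ≤ 1 := by
  rw [norm_div, Real.norm_eq_abs, Real.norm_eq_abs]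
  apply div_le_one_of_le₀ _ (abs_nonneg u)
  rcases le_total 0 u with h | h
  · rw [abs_of_nonneg h, abs_of_nonneg (Real.arctan_nonneg.2 h)]
    exact aux_arctan_le h
  · have h3 : 0 ≤ -u := by linarith
    rw [← abs_neg, ← abs_neg u, ← Real.arctan_neg, abs_of_nonneg h3,
      abs_of_nonneg (Real.arctan_nonneg.2 h3)]
    exact aux_arctan_le h3

lemma aux_meas : Measurable (fun u : ℝ => Real.arctan u / u) :=
  Real.continuous_arctan.measurable.div measurable_id

lemma aux_int (a b : ℝ) :
    IntervalIntegrable (fun u : ℝ => Real.arctan u / u) volume a b := by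
  apply (intervalIntegrable_const (c := (1:ℝ))).mono_fun aux_meas.aestronglyMeasurable
  filter_upwards with u
  simpa using aux_bound u

lemma aux_Ti2_deriv {x : ℝ} (hx : 0 < x) : HasDerivAt Ti2 (Real.arctan x / x) x := by
  apply intervalIntegral.integral_hasDerivAt_right (aux_int 0 x)
  · exact aux_meas.stronglyMeasurable.stronglyMeasurableAtFilter
  · exact Real.continuous_arctan.continuousAt.div continuousAt_id hx.ne'

lemma aux_Ti2_le (x : ℝ) : ‖Ti2 x‖ ≤ |x| := by
  have := intervalIntegral.norm_integral_le_of_norm_le_const (a := 0) (b := x) (C := 1)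
    (f := fun u : ℝ => Real.arctan u / u) (fun u _ => aux_bound u)
  simpa [Ti2] using this

lemma aux_catalan : Ti2 1 = catalanG := by
  unfold Ti2 catalanG
  rw [intervalIntegral.integral_of_le zero_le_one]
  have hI : ∀ k : ℕ, ∫ x in Set.Ioc (0:ℝ) 1, x ^ (2 * k) / (2 * (k:ℝ) + 1)
      = 1 / (2 * (k:ℝ) + 1) ^ 2 := by
    intro k
    rw [← intervalIntegral.integral_of_le zero_le_one, intervalIntegral.integral_div,
      integral_pow]
    push_cast
    have : (2 * (k:ℝ) + 1) ≠ 0 := by positivity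
    simp
    field_simp
  have hs : Summable (fun k : ℕ => 1 / (2 * (k:ℝ) + 1) ^ 2) := by
    have h := (Real.summable_one_div_nat_pow (p := 2)).2 (by norm_num)
    have h2 := h.comp_injective (i := fun k : ℕ => 2 * k + 1) (by intro a b; simp)
    refine h2.congr ?_
    intro k
    simp
  have key := MeasureTheory.hasSum_integral_of_summable_integral_norm
    (μ := volume.restrict (Set.Ioc (0:ℝ) 1))
    (F := fun (k : ℕ) (x : ℝ) => (-1 : ℝ) ^ k * (x ^ (2 * k) / (2 * (k:ℝ) + 1))) ?_ ?_
  · rw [← key.tsum_eq.symm.trans (tsum_congr ?_)]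
    · apply MeasureTheory.integral_congr_ae
      rw [Filter.EventuallyEq, MeasureTheory.ae_restrict_iff' measurableSet_Ioc]
      have h1 : ∀ᵐ x : ℝ, x ≠ 1 := by simp [ae_iff]
      filter_upwards [h1] with x hx1 hx
      have hx2 : ‖x‖ < 1 := by
        rw [Real.norm_eq_abs, abs_of_pos hx.1]
        exact lt_of_le_of_ne hx.2 hx1
      have h3 := (Real.hasSum_arctan hx2).div_const x
      rw [← h3.tsum_eq]
      apply tsum_congr
      intro k
      have := hx.1.ne'
      push_cast
      field_simp
      ring
    · intro k
      rw [MeasureTheory.integral_const_mul, hI]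
      ring
  · intro k
    have : Continuous (fun x : ℝ => (-1 : ℝ) ^ k * (x ^ (2 * k) / (2 * (k:ℝ) + 1))) := by
      fun_prop
    exact (this.integrableOn_Icc (a := 0) (b := 1)).mono_set Set.Ioc_subset_Icc_self
  · refine hs.congr ?_
    intro k
    rw [← hI]
    apply MeasureTheory.integral_congr_ae
    filter_upwards with x
    have : (0:ℝ) ≤ x ^ (2 * k) / (2 * (k:ℝ) + 1) := by
      rw [pow_mul]; positivity
    rw [norm_mul, norm_pow, norm_neg, norm_one, one_pow, one_mul, Real.norm_of_nonneg this]

lemma aux_log_tan : (∫ x in (0:ℝ)..(π / 4), (Real.log (Real.sin x) - Real.log (Real.cos x)))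
    = - Ti2 1 := by
  have hpi := Real.pi_pos
  have hd : ∀ x ∈ Set.Ioc (0:ℝ) (π / 4), HasDerivAt
      (fun x => x * Real.log (Real.tan x) - Ti2 (Real.tan x))
      (Real.log (Real.sin x) - Real.log (Real.cos x)) x := by
    intro x hx
    have hc : 0 < Real.cos x := Real.cos_pos_of_mem_Ioo ⟨by linarith [hx.1], by linarith [hx.2]⟩
    have hs : 0 < Real.sin x := Real.sin_pos_of_pos_of_lt_pi hx.1 (by linarith [hx.2])
    have ht : 0 < Real.tan x := by rw [Real.tan_eq_sin_div_cos]; positivity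
    have h1 := Real.hasDerivAt_tan hc.ne'
    have h2 := ((hasDerivAt_id x).mul (h1.log ht.ne')).sub ((aux_Ti2_deriv ht).comp x h1)
    refine HasDerivAt.congr_deriv h2 ?_
    rw [Real.arctan_tan (by linarith [hx.1]) (by linarith [hx.2]), Real.tan_eq_sin_div_cos,
      Real.log_div hs.ne' hc.ne']
    simp only [id]
    ring
  have hq : (0:ℝ) < π / 4 := by linarith
  rw [intervalIntegral.integral_eq_sub_of_hasDerivAt_of_tendsto hq
    (fun x hx => hd x ⟨hx.1, hx.2.le⟩) (fa := 0) (fb := - Ti2 1)]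
  · ring
  · exact intervalIntegrable_log_sin.sub intervalIntegrable_log_cos
  · have htan : Filter.Tendsto Real.tan (nhdsWithin 0 (Set.Ioi 0)) (nhds 0) := by
      have : ContinuousAt Real.tan 0 := Real.continuousAt_tan.2 (by simp)
      have h := this.tendsto
      rw [Real.tan_zero] at h
      exact h.mono_left nhdsWithin_le_nhds
    have hlt : Filter.Tendsto (fun x => Real.tan x * Real.log (Real.tan x))
        (nhdsWithin 0 (Set.Ioi 0)) (nhds 0) := by
      have h := Real.continuous_mul_log.tendsto 0
      simp only [zero_mul] at h
      exact h.comp htan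
    have hb : Filter.Tendsto (fun x => |Real.tan x * Real.log (Real.tan x)| + |Real.tan x|)
        (nhdsWithin 0 (Set.Ioi 0)) (nhds 0) := by
      simpa using hlt.abs.add htan.abs
    apply squeeze_zero_norm' _ hb
    filter_upwards [Ioo_mem_nhdsGT hq] with x hx
    refine (norm_sub_le _ _).trans (add_le_add ?_ (aux_Ti2_le _))
    rw [Real.norm_eq_abs, abs_mul, abs_mul]
    apply mul_le_mul_of_nonneg_right _ (abs_nonneg _)
    have := Real.le_tan hx.1.le (by linarith [hx.2])
    rw [abs_of_pos hx.1, abs_of_nonneg (hx.1.le.trans this)]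
    exact this
  · have h := (hd (π/4) ⟨hq, le_rfl⟩).continuousAt.tendsto
    simp only [Real.tan_pi_div_four, Real.log_one, mul_zero, zero_sub] at h
    exact h.mono_left nhdsWithin_le_nhds

lemma aux_log_cos : (∫ x in (0:ℝ)..(π / 4), Real.log (Real.cos x))
    = (catalanG - π / 2 * Real.log 2) / 2 := by
  have h1 := aux_log_tan
  have is : ∀ a b : ℝ, IntervalIntegrable (fun x => Real.log (Real.sin x)) volume a b :=
    fun a b => intervalIntegrable_log_sin
  have ic : ∀ a b : ℝ, IntervalIntegrable (fun x => Real.log (Real.cos x)) volume a b :=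
    fun a b => intervalIntegrable_log_cos
  rw [intervalIntegral.integral_sub (is _ _) (ic _ _), aux_catalan] at h1
  have h2 := integral_log_sin_zero_pi_div_two
  rw [← intervalIntegral.integral_add_adjacent_intervals (b := π / 4) (is _ _) (is _ _)] at h2
  have h3 : (∫ x in (π/4)..(π/2), Real.log (Real.sin x))
      = ∫ x in (0:ℝ)..(π / 4), Real.log (Real.cos x) := by
    have := intervalIntegral.integral_comp_sub_left (a := 0) (b := π/4)
      (fun x => Real.log (Real.sin x)) (π / 2)
    simp only [Real.sin_pi_div_two_sub] at this
    rw [this]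
    congr 1 <;> ring
  rw [h3] at h2
  linarith

lemma aux_K0 : (∫ x in (0:ℝ)..1, Real.log (1 + x ^ 2) / (1 + x ^ 2))
    = π / 2 * Real.log 2 - catalanG := by
  have h := intervalIntegral.integral_comp_mul_deriv' (a := 0) (b := 1) (f := Real.arctan)
    (f' := fun x => 1 / (1 + x ^ 2)) (g := fun x => Real.log (Real.cos x))
    (fun x _ => Real.hasDerivAt_arctan x) ?_ ?_
  · rw [Real.arctan_zero, Real.arctan_one, aux_log_cos] at h
    have h2 : (∫ x in (0:ℝ)..1, Real.log (1 + x ^ 2) / (1 + x ^ 2)) =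
      ∫ x in (0:ℝ)..1, (-2) * (((fun x => Real.log (Real.cos x)) ∘ Real.arctan) x
        * (1 / (1 + x ^ 2))) := by
      congr 1
      ext x
      have h3 := Real.cos_sq_arctan x
      have h4 := congrArg Real.log h3
      rw [Real.log_pow, one_div, Real.log_inv] at h4
      push_cast at h4
      simp only [Function.comp]
      have : Real.log (1 + x ^ 2) = -2 * Real.log (Real.cos (Real.arctan x)) := by linarith
      rw [this]
      ring
    rw [h2, intervalIntegral.integral_const_mul, h]
    ring
  · apply Continuous.continuousOn
    exact continuous_const.div (by fun_prop) (fun x => by positivity)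
  · rintro y ⟨x, -, rfl⟩
    apply ContinuousAt.continuousWithinAt
    exact Real.continuous_cos.continuousAt.log (Real.cos_arctan_pos x).ne'

lemma aux_atan_int : (∫ x in (0:ℝ)..1, 1 / (1 + x ^ 2)) = π / 4 := by
  rw [integral_one_div_one_add_sq]; simp

lemma aux_log_one_add : (∫ x in (0:ℝ)..1, Real.log (1 + x) / (1 + x ^ 2))
    = π / 8 * Real.log 2 := by
  have hu : Set.uIcc (0:ℝ) 1 = Set.Icc 0 1 := Set.uIcc_of_le zero_le_one
  have hcont : ContinuousOn (fun x : ℝ => Real.log (1 + x) / (1 + x ^ 2)) (Set.Icc 0 1) := by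
    apply ContinuousOn.div
    · apply ContinuousOn.log (by fun_prop)
      intro x hx; have := hx.1; positivity
    · fun_prop
    · intro x _; positivity
  have h := intervalIntegral.integral_comp_mul_deriv' (a := 0) (b := 1)
    (f := fun x : ℝ => (1 - x) / (1 + x))
    (f' := fun x => -2 / (1 + x) ^ 2) (g := fun x : ℝ => Real.log (1 + x) / (1 + x ^ 2)) ?_ ?_ ?_
  · have e0 : ((1:ℝ) - 0) / (1 + 0) = 1 := by norm_num
    have e1 : ((1:ℝ) - 1) / (1 + 1) = 0 := by norm_num
    simp only [e0, e1] at h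
    rw [intervalIntegral.integral_symm 0 1] at h
    have h2 : (∫ x in (0:ℝ)..1, ((fun x : ℝ => Real.log (1 + x) / (1 + x ^ 2)) ∘
        (fun x : ℝ => (1 - x) / (1 + x))) x * (-2 / (1 + x) ^ 2))
        = ∫ x in (0:ℝ)..1, (Real.log (1 + x) / (1 + x ^ 2) - Real.log 2 * (1 / (1 + x ^ 2))) := by
      apply intervalIntegral.integral_congr
      intro x hx
      rw [hu] at hx
      have hx0 := hx.1
      have h1 : (1 + x) ≠ 0 := by positivity
      have h3 : 1 + (1 - x) / (1 + x) = 2 / (1 + x) := by field_simp; ring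
      have h4 : 1 + ((1 - x) / (1 + x)) ^ 2 = 2 * (1 + x ^ 2) / (1 + x) ^ 2 := by
        field_simp; ring
      have h5 : (1 + x ^ 2) ≠ 0 := by positivity
      simp only [Function.comp]
      rw [h3, h4, Real.log_div two_ne_zero h1]
      field_simp
      ring
    rw [h2, intervalIntegral.integral_sub, intervalIntegral.integral_const_mul,
      aux_atan_int] at h
    · linarith
    · apply ContinuousOn.intervalIntegrable; rw [hu]; exact hcont
    · apply Continuous.intervalIntegrable
      exact continuous_const.mul (continuous_const.div (by fun_prop) (fun x => by positivity))
  · intro x hx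
    rw [hu] at hx
    have hx0 := hx.1
    have h1 : (1 + x) ≠ 0 := by positivity
    have := ((hasDerivAt_id x).const_sub 1).div ((hasDerivAt_id x).const_add 1) h1
    refine HasDerivAt.congr_deriv this ?_
    simp only [id]
    field_simp
    ring
  · rw [hu]
    apply ContinuousOn.div (by fun_prop) (by fun_prop)
    intro x hx; have := hx.1; positivity
  · apply hcont.mono
    rintro y ⟨x, hx, rfl⟩
    rw [hu] at hx
    have := hx.1; have := hx.2
    refine ⟨div_nonneg (by linarith) (by linarith), ?_⟩
    show (1 - x) / (1 + x) ≤ 1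
    rw [div_le_one (by linarith)]
    linarith

lemma aux_D_pos {s : ℝ} (hs : 0 ≤ s) (hs1 : s < 1) (x : ℝ) :
    0 < (1 + s ^ 2) * (1 + x ^ 2) - 4 * s * x := by
  nlinarith [sq_nonneg (x - s), sq_nonneg (1 - s * x), sq_nonneg ((1+s^2)*x - 2 * s),
    sq_nonneg (1 - s ^ 2), mul_pos (show 0 < 1 - s by linarith) (show 0 < 1 + s by linarith),
    sq_nonneg (x - 1), sq_nonneg (x+1), mul_nonneg hs (sq_nonneg (x - 1)),
    mul_pos (show 0 < 1 - s by linarith) (show 0 < 1 - s by linarith),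
    mul_nonneg (sq_nonneg (1 - s)) (sq_nonneg x)]

lemma aux_inner {s : ℝ} (hs : 0 < s) (hs1 : s < 1) :
    (∫ x in (0:ℝ)..1, (2 * s * (1 + x ^ 2) - 4 * x) /
      ((1 + s ^ 2) * (1 + x ^ 2) - 4 * s * x) / (1 + x ^ 2)) = - (Real.arctan s / s) := by
  have hs2 : 0 < 1 - s ^ 2 := by nlinarith
  have hd : ∀ x ∈ Set.uIcc (0:ℝ) 1, HasDerivAt
      (fun x => (1 / s) * (Real.arctan x - Real.arctan (((1 + s ^ 2) * x - 2 * s) / (1 - s ^ 2))))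
      ((2 * s * (1 + x ^ 2) - 4 * x) /
      ((1 + s ^ 2) * (1 + x ^ 2) - 4 * s * x) / (1 + x ^ 2)) x := by
    intro x _
    have h1 : HasDerivAt (fun x => ((1 + s ^ 2) * x - 2 * s) / (1 - s ^ 2))
        ((1 + s ^ 2) / (1 - s ^ 2)) x := by
      have := (((hasDerivAt_id x).const_mul (1 + s ^ 2)).sub_const (2 * s)).div_const (1 - s ^ 2)
      simpa using this
    have h2 := ((Real.hasDerivAt_arctan x).sub h1.arctan).const_mul (1 / s)
    refine HasDerivAt.congr_deriv h2 ?_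
    have hD := aux_D_pos hs.le hs1 x
    have e : 1 + (((1 + s ^ 2) * x - 2 * s) / (1 - s ^ 2)) ^ 2 =
      (1 + s ^ 2) * ((1 + s ^ 2) * (1 + x ^ 2) - 4 * s * x) / (1 - s ^ 2) ^ 2 := by
      field_simp; ring
    rw [e]
    have hx : 0 < 1 + x ^ 2 := by positivity
    have hss : 0 < 1 + s ^ 2 := by positivity
    generalize hDD : (1 + s ^ 2) * (1 + x ^ 2) - 4 * s * x = D at *
    field_simp
    rw [← hDD]
    ring
  rw [intervalIntegral.integral_eq_sub_of_hasDerivAt hd]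
  · have a1 : ((1 + s ^ 2) * 1 - 2 * s) / (1 - s ^ 2) = (1 - s) / (1 + s) := by
      have : 1 + s ≠ 0 := by positivity
      field_simp; ring
    have a2 : Real.arctan ((1 - s) / (1 + s)) = π / 4 - Real.arctan s := by
      have := Real.arctan_add (x := 1) (y := -s) (by linarith)
      rw [Real.arctan_one, Real.arctan_neg] at this
      rw [sub_eq_add_neg (π / 4), this]
      congr 1; ring
    have a3 : ((1 + s ^ 2) * 0 - 2 * s) / (1 - s ^ 2) = - (2 * s / (1 - s ^ 2)) := by ring
    rw [a1, a2, a3, Real.arctan_neg, ← Real.two_mul_arctan (by linarith) hs1, Real.arctan_one,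
      Real.arctan_zero]
    field_simp
    ring
  · apply Continuous.intervalIntegrable
    apply Continuous.div (Continuous.div (by fun_prop) (by fun_prop) ?_) (by fun_prop) ?_
    · intro x; exact (aux_D_pos hs.le hs1 x).ne'
    · intro x; positivity

lemma aux_K {r : ℝ} (hr : 0 < r) (hr1 : r < 1) :
    (∫ x in (0:ℝ)..1, Real.log ((1 + r ^ 2) * (1 + x ^ 2) - 4 * r * x) / (1 + x ^ 2))
      - (∫ x in (0:ℝ)..1, Real.log (1 + x ^ 2) / (1 + x ^ 2)) = - Ti2 r := by
  have hu : Set.uIcc (0:ℝ) r = Set.Icc 0 r := Set.uIcc_of_le hr.le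
  have hF : ∀ x : ℝ, (∫ s in (0:ℝ)..r, (2 * s * (1 + x ^ 2) - 4 * x) /
      ((1 + s ^ 2) * (1 + x ^ 2) - 4 * s * x) / (1 + x ^ 2)) =
      Real.log ((1 + r ^ 2) * (1 + x ^ 2) - 4 * r * x) / (1 + x ^ 2)
        - Real.log (1 + x ^ 2) / (1 + x ^ 2) := by
    intro x
    rw [intervalIntegral.integral_eq_sub_of_hasDerivAt (f := fun s =>
      Real.log ((1 + s ^ 2) * (1 + x ^ 2) - 4 * s * x) / (1 + x ^ 2))]
    · simp
    · intro s hs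
      rw [hu] at hs
      have hD := aux_D_pos hs.1 (lt_of_le_of_lt hs.2 hr1) x
      have h1 : HasDerivAt (fun s => (1 + s ^ 2) * (1 + x ^ 2) - 4 * s * x)
          (2 * s * (1 + x ^ 2) - 4 * x) s := by
        have := ((((hasDerivAt_id s).pow 2).const_add 1).mul_const (1 + x ^ 2)).sub
          (((hasDerivAt_id s).const_mul 4).mul_const x)
        refine HasDerivAt.congr_deriv this ?_
        simp
      exact (h1.log hD.ne').div_const _
    · apply ContinuousOn.intervalIntegrable
      rw [hu]
      apply ContinuousOn.div (ContinuousOn.div (by fun_prop) (by fun_prop) ?_) (by fun_prop) ?_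
      · intro s hs; exact (aux_D_pos hs.1 (lt_of_le_of_lt hs.2 hr1) x).ne'
      · intro s _; positivity
  have hi0 : Continuous (fun x : ℝ => Real.log (1 + x ^ 2) / (1 + x ^ 2)) := by
    apply Continuous.div (Continuous.log (by fun_prop) ?_) (by fun_prop) ?_ <;>
    · intro x; positivity
  have hir : Continuous (fun x : ℝ =>
      Real.log ((1 + r ^ 2) * (1 + x ^ 2) - 4 * r * x) / (1 + x ^ 2)) := by
    apply Continuous.div (Continuous.log (by fun_prop) ?_) (by fun_prop) ?_
    · intro x; exact (aux_D_pos hr.le hr1 x).ne'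
    · intro x; positivity
  rw [← intervalIntegral.integral_sub (hir.intervalIntegrable _ _) (hi0.intervalIntegrable _ _)]
  simp_rw [← hF]
  rw [MeasureTheory.intervalIntegral_intervalIntegral_swap]
  · unfold Ti2
    rw [← intervalIntegral.integral_neg]
    apply intervalIntegral.integral_congr_ae
    filter_upwards with s hs
    rw [Set.uIoc_of_le hr.le] at hs
    exact aux_inner hs.1 (lt_of_le_of_lt hs.2 hr1)
  · have : ContinuousOn (Function.uncurry fun (x s : ℝ) => (2 * s * (1 + x ^ 2) - 4 * x) /
      ((1 + s ^ 2) * (1 + x ^ 2) - 4 * s * x) / (1 + x ^ 2)) (Set.Icc 0 1 ×ˢ Set.Icc 0 r) := by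
      unfold Function.uncurry
      apply ContinuousOn.div (ContinuousOn.div (by fun_prop) (by fun_prop) ?_) (by fun_prop) ?_
      · intro p hp; exact (aux_D_pos hp.2.1 (lt_of_le_of_lt hp.2.2 hr1) p.1).ne'
      · intro p _; positivity
    refine (this.integrableOn_compact (isCompact_Icc.prod isCompact_Icc)).mono_set ?_
    rw [Set.uIoc_of_le hr.le, Set.uIoc_of_le zero_le_one]
    exact Set.prod_mono Set.Ioc_subset_Icc_self Set.Ioc_subset_Icc_self

theorem stmt_8 :
    ∫ x in (0:ℝ)..1, Real.log (x ^ 3 + 1) / (x ^ 2 + 1) =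
      -(π / 8) * Real.log 2 - catalanG + (π / 2) * Real.log (1 + Real.sqrt 3)
        - Ti2 (2 - Real.sqrt 3) := by
  have hu : Set.uIcc (0:ℝ) 1 = Set.Icc 0 1 := Set.uIcc_of_le zero_le_one
  have h3 : Real.sqrt 3 ^ 2 = 3 := Real.sq_sqrt (by norm_num)
  have h3p : 0 < Real.sqrt 3 := by positivity
  have hr : 0 < 2 - Real.sqrt 3 := by nlinarith
  have hr1 : 2 - Real.sqrt 3 < 1 := by nlinarith
  have hK := aux_K hr hr1
  rw [aux_K0] at hK
  have hq : ∀ x : ℝ, 0 < x ^ 2 - x + 1 := fun x => by nlinarith [sq_nonneg (x - 1 / 2)]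
  have hlog : Real.log (4 * (2 - Real.sqrt 3)) = 3 * Real.log 2 - 2 * Real.log (1 + Real.sqrt 3) := by
    have : 4 * (2 - Real.sqrt 3) = 2 ^ 3 / (1 + Real.sqrt 3) ^ 2 := by
      field_simp
      nlinarith
    rw [this, Real.log_div (by positivity) (by positivity), Real.log_pow, Real.log_pow]
    norm_num
  have hc1 : IntervalIntegrable (fun x : ℝ => 1 / (1 + x ^ 2)) volume 0 1 := by
    apply Continuous.intervalIntegrable
    exact continuous_const.div (by fun_prop) (fun x => by positivity)
  have hc2 : IntervalIntegrable (fun x : ℝ => Real.log (x ^ 2 - x + 1) / (1 + x ^ 2))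
      volume 0 1 := by
    apply Continuous.intervalIntegrable
    apply Continuous.div (Continuous.log (by fun_prop) ?_) (by fun_prop) ?_
    · intro x; exact (hq x).ne'
    · intro x; positivity
  have hc3 : IntervalIntegrable (fun x : ℝ => Real.log (1 + x) / (1 + x ^ 2)) volume 0 1 := by
    apply ContinuousOn.intervalIntegrable
    rw [hu]
    apply ContinuousOn.div (ContinuousOn.log (by fun_prop) ?_) (by fun_prop) ?_
    · intro x hx; have := hx.1; positivity
    · intro x _; positivity
  have e1 : (∫ x in (0:ℝ)..1, Real.log ((1 + (2 - Real.sqrt 3) ^ 2) * (1 + x ^ 2)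
      - 4 * (2 - Real.sqrt 3) * x) / (1 + x ^ 2)) =
      Real.log (4 * (2 - Real.sqrt 3)) * (π / 4)
        + ∫ x in (0:ℝ)..1, Real.log (x ^ 2 - x + 1) / (1 + x ^ 2) := by
    rw [← aux_atan_int, ← intervalIntegral.integral_const_mul,
      ← intervalIntegral.integral_add (hc1.const_mul _) hc2]
    congr 1
    ext x
    have : (1 + (2 - Real.sqrt 3) ^ 2) * (1 + x ^ 2) - 4 * (2 - Real.sqrt 3) * x
        = (4 * (2 - Real.sqrt 3)) * (x ^ 2 - x + 1) := by
      linear_combination (1 + x ^ 2) * h3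
    rw [this, Real.log_mul (by positivity) (hq x).ne']
    ring
  have e2 : (∫ x in (0:ℝ)..1, Real.log (x ^ 3 + 1) / (x ^ 2 + 1)) =
      (∫ x in (0:ℝ)..1, Real.log (1 + x) / (1 + x ^ 2))
        + ∫ x in (0:ℝ)..1, Real.log (x ^ 2 - x + 1) / (1 + x ^ 2) := by
    rw [← intervalIntegral.integral_add hc3 hc2]
    apply intervalIntegral.integral_congr
    intro x hx
    rw [hu] at hx
    have hx0 := hx.1
    have : x ^ 3 + 1 = (1 + x) * (x ^ 2 - x + 1) := by ring
    simp only
    rw [this, Real.log_mul (by positivity) (hq x).ne', add_comm (x ^ 2) 1]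
    ring
  rw [e1, hlog] at hK
  rw [e2, aux_log_one_add]
  linear_combination hK
end
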